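/- Let d ≥ 1, T ∈ (-∞,∞], p ∈ (1,∞), α ∈ (0,2), β ≥ 1, and γ > -1. Then there exists N > 0, depending only on d, p, β, γ, such that for every smooth function u : ℝ × ℝ^d → ℝ with compact support contained in Ω_T = (-∞,T) × ℝ^d_+, one has ‖ x_d^{-α} min{x_d^β, 1} |Du| ‖_{L_p(Ω_T, x_d^γ dz)} ≤ N ‖χ^{-α} u‖_{L_p(Ω_T, x_d^γ dz)}^{1/2} ‖D²u‖_{L_p(Ω_T, x_d^γ dz)}^{1/2} + N ‖χ^{-α} u‖_{L_p(Ω_T, x_d^γ dz)}. -/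

import Mathlib

open MeasureTheory ENNReal Set

noncomputable section

abbrev Ed (d : ℕ) : Type := EuclideanSpace ℝ (Fin d)

/-- The last coordinate `x_d` of a point `x ∈ ℝ^d` (junk value `0` if `d = 0`). -/
def xd {d : ℕ} (x : Ed d) : ℝ :=
  if h : 0 < d then x ⟨d - 1, Nat.sub_lt h one_pos⟩ else 0

/-- `Ω_T = (-∞, T) × ℝ^d_+`. -/
def OmegaT (d : ℕ) (T : EReal) : Set (ℝ × Ed d) :=
  {z | (z.1 : EReal) < T ∧ 0 < xd z.2}

/-- Time derivative `u_t`. -/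
def ut {d : ℕ} (u : ℝ × Ed d → ℝ) (z : ℝ × Ed d) : ℝ :=
  deriv (fun s => u (s, z.2)) z.1

/-- Spatial gradient `Du`. -/
def Du {d : ℕ} (u : ℝ × Ed d → ℝ) (z : ℝ × Ed d) : Ed d →L[ℝ] ℝ :=
  fderiv ℝ (fun y => u (z.1, y)) z.2

/-- Spatial Hessian `D²u`. -/
def D2u {d : ℕ} (u : ℝ × Ed d → ℝ) (z : ℝ × Ed d) : Ed d →L[ℝ] Ed d →L[ℝ] ℝ :=
  fderiv ℝ (fun y => Du u (z.1, y)) z.2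

/-- Spatial Laplacian `Δu`. -/
def lap {d : ℕ} (u : ℝ × Ed d → ℝ) (z : ℝ × Ed d) : ℝ :=
  ∑ i : Fin d, D2u u z (EuclideanSpace.single i 1) (EuclideanSpace.single i 1)

/-- Weighted Lebesgue norm `‖g‖_{L_p(Ω_T, x_d^γ dz)}`. -/
def wLp (d : ℕ) (T : EReal) (p γ : ℝ) (g : ℝ × Ed d → ℝ) : ℝ≥0∞ :=
  (∫⁻ z in OmegaT d T, ENNReal.ofReal (|g z| ^ p * xd z.2 ^ γ)) ^ (1 / p)

/-- The map `z ↦ z + c ℓ(z) / (1 + ℓ(z)) v` does not decrease volume where `ℓ > 0`. -/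
theorem lintegral_comp_add_smul_le {E : Type*} [NormedAddCommGroup E] [NormedSpace ℝ E]
    [FiniteDimensional ℝ E] [MeasurableSpace E] [BorelSpace E] (μ : Measure E)
    [μ.IsAddHaarMeasure] (l : E →L[ℝ] ℝ) {v : E} (hv : 0 ≤ l v) {S : Set E}
    (hS : MeasurableSet S) (hpos : ∀ z ∈ S, 0 < l z)
    (hcl : ∀ z ∈ S, ∀ t : ℝ, 0 ≤ t → z + t • v ∈ S) {c : ℝ} (hc : 0 ≤ c) (g : E → ℝ≥0∞) :
    ∫⁻ z in S, g (z + (c * (l z / (1 + l z))) • v) ∂μ ≤ ∫⁻ z in S, g z ∂μ := by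
  let φ : E → E := fun z => z + (c * (l z / (1 + l z))) • v
  let φ' : E → E →L[ℝ] E := fun z =>
    ContinuousLinearMap.id ℝ E + (((c / (1 + l z) ^ 2) • l).smulRight v)
  have hderiv : ∀ z ∈ S, HasFDerivWithinAt φ (φ' z) S z := by
    intro z hz
    have hne : 1 + l z ≠ 0 := by linarith [hpos z hz]
    have h1 : HasDerivAt (fun y : ℝ => c * (y / (1 + y))) (c / (1 + l z) ^ 2) (l z) := by
      have := ((hasDerivAt_id (l z)).div ((hasDerivAt_id (l z)).const_add 1) hne).const_mul c
      refine this.congr_deriv ?_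
      simp only [id]
      field_simp
      ring
    have h2 : HasFDerivAt (fun z => c * (l z / (1 + l z))) ((c / (1 + l z) ^ 2) • l) z :=
      h1.comp_hasFDerivAt z l.hasFDerivAt
    exact ((hasFDerivAt_id z).add (h2.smul_const v)).hasFDerivWithinAt
  have hinj : InjOn φ S := by
    intro x hx y hy hxy
    have hx0 := hpos x hx
    have hy0 := hpos y hy
    have h1 : l x + c * (l x / (1 + l x)) * l v = l y + c * (l y / (1 + l y)) * l v := by
      simpa [φ] using congrArg l hxy
    have h2 : l x / (1 + l x) - l y / (1 + l y)
        = (l x - l y) * (1 / ((1 + l x) * (1 + l y))) := by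
      field_simp
      ring
    have h3 : (l x - l y) * (1 + c * (1 / ((1 + l x) * (1 + l y))) * l v) = 0 := by
      linear_combination h1 - c * l v * h2
    have h4 : 0 < 1 + c * (1 / ((1 + l x) * (1 + l y))) * l v := by positivity
    have h5 : l x = l y := by
      rcases mul_eq_zero.1 h3 with h | h
      · linarith
      · exact absurd h h4.ne'
    simpa [φ, h5] using hxy
  have hdet : ∀ z ∈ S, 1 ≤ ENNReal.ofReal |(φ' z).det| := by
    intro z hz
    have h0 := hpos z hz
    have : (φ' z).det = 1 + c / (1 + l z) ^ 2 * l v := by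
      have h := LinearMap.transvection.det (((c / (1 + l z) ^ 2) • l : E →L[ℝ] ℝ) : E →ₗ[ℝ] ℝ) v
      rw [ContinuousLinearMap.det]
      convert h using 2
      · ext w
        simp [φ', LinearMap.transvection.apply]
      · simp
    rw [this, ENNReal.one_le_ofReal]
    refine le_trans ?_ (le_abs_self _)
    have : 0 ≤ c / (1 + l z) ^ 2 * l v := by positivity
    linarith
  calc ∫⁻ z in S, g (φ z) ∂μ ≤ ∫⁻ z in S, ENNReal.ofReal |(φ' z).det| * g (φ z) ∂μ := by
        refine setLIntegral_mono' hS fun z hz => ?_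
        simpa using mul_le_mul_left (hdet z hz) (g (φ z))
    _ = ∫⁻ z in φ '' S, g z ∂μ :=
        (lintegral_image_eq_lintegral_abs_det_fderiv_mul μ hS hderiv hinj g).symm
    _ ≤ ∫⁻ z in S, g z ∂μ := by
        refine lintegral_mono_set ?_
        rintro _ ⟨z, hz, rfl⟩
        have := hpos z hz
        exact hcl z hz _ (by positivity)

theorem abs_deriv_zero_le {f f' f'' : ℝ → ℝ} (hf : ∀ s, HasDerivAt f (f' s) s)
    (hf' : ∀ s, HasDerivAt f' (f'' s) s) (hc : Continuous f'') :
    |f' 0| ≤ |f 1| + |f 0| + ∫ s in (0 : ℝ)..1, |f'' s| := by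
  obtain ⟨ξ, hξ, h1⟩ := exists_hasDerivAt_eq_slope f f' (zero_lt_one' ℝ)
    (fun s _ => (hf s).continuousAt.continuousWithinAt) (fun s _ => hf s)
  have h2 : ∫ s in (0 : ℝ)..ξ, f'' s = f' ξ - f' 0 :=
    intervalIntegral.integral_eq_sub_of_hasDerivAt (fun s _ => hf' s) (hc.intervalIntegrable _ _)
  have h3 : |∫ s in (0 : ℝ)..ξ, f'' s| ≤ ∫ s in (0 : ℝ)..1, |f'' s| := by
    refine (intervalIntegral.abs_integral_le_integral_abs hξ.1.le).trans ?_
    exact intervalIntegral.integral_mono_interval le_rfl hξ.1.le hξ.2.le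
      (Filter.Eventually.of_forall fun s => abs_nonneg _) (hc.abs.intervalIntegrable _ _)
  have h4 : f' 0 = f 1 - f 0 - ∫ s in (0 : ℝ)..ξ, f'' s := by
    rw [h2, h1]; ring
  rw [h4]
  exact (abs_sub _ _).trans (add_le_add (abs_sub _ _) h3)

theorem lintegral_rpow_le_lintegral_rpow {Ω : Type*} [MeasurableSpace Ω] (μ : Measure Ω)
    [IsProbabilityMeasure μ] {p : ℝ} (hp : 1 < p) {f : Ω → ℝ≥0∞} (hf : AEMeasurable f μ) :
    (∫⁻ s, f s ∂μ) ^ p ≤ ∫⁻ s, f s ^ p ∂μ := by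
  have hpq := Real.HolderConjugate.conjExponent hp
  have h := ENNReal.lintegral_mul_le_Lp_mul_Lq μ hpq hf (g := fun _ => 1) aemeasurable_const
  simp only [Pi.mul_apply, mul_one, ENNReal.one_rpow, lintegral_const, measure_univ] at h
  have h2 := ENNReal.rpow_le_rpow h (by linarith : 0 ≤ p)
  rwa [← ENNReal.rpow_mul, one_div_mul_cancel (by linarith : p ≠ 0), ENNReal.rpow_one] at h2

/-- Real-variable weight comparison behind the interpolation inequality. -/
theorem weight_mul_le {x y α β t D U V J : ℝ} (hx : 0 < x) (hβ : 1 ≤ β) (hα : α ∈ Ioo (0 : ℝ) 2)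
    (ht : 0 < t) (hxy : x ≤ y) (hy : y ≤ 2 * x) (hU : 0 ≤ U) (hV : 0 ≤ V)
    (hJ : 0 ≤ J)
    (h : t * (x / (1 + x)) * D ≤ U + V + (t * (x / (1 + x))) ^ 2 * J) :
    x ^ (-α) * min (x ^ β) 1 * D ≤ 8 * t⁻¹ * (y ^ (-α) * U + x ^ (-α) * V) + t * J := by
  obtain ⟨hα0, hα2⟩ := hα
  set k := x / (1 + x) with hk
  have hk0 : 0 < k := by positivity
  have hm : min (x ^ β) 1 ≤ 2 * k := by
    rw [hk]
    rcases le_total x 1 with h1 | h1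
    · refine (min_le_left _ _).trans ?_
      have : x ^ β ≤ x := by
        simpa using Real.rpow_le_rpow_of_exponent_ge hx h1 hβ
      refine this.trans ?_
      rw [mul_div_assoc', le_div_iff₀ (by linarith)]
      nlinarith
    · refine (min_le_right _ _).trans ?_
      rw [mul_div_assoc', le_div_iff₀ (by linarith)]
      nlinarith
  have hm0 : 0 ≤ min (x ^ β) 1 := le_min (by positivity) zero_le_one
  have hmk : x ^ (-α) * min (x ^ β) 1 * k ≤ 1 := by
    have hkx : k ≤ x := by rw [hk]; exact div_le_self hx.le (by linarith)
    have hk1 : k ≤ 1 := by rw [hk, div_le_one (by linarith)]; linarith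
    rcases le_total x 1 with h1 | h1
    · have h2 : x ^ β ≤ x := by
        simpa using Real.rpow_le_rpow_of_exponent_ge hx h1 hβ
      have h3 : x ^ (-α) ≤ x ^ (-2 : ℝ) :=
        Real.rpow_le_rpow_of_exponent_ge hx h1 (by linarith)
      calc x ^ (-α) * min (x ^ β) 1 * k ≤ x ^ (-2 : ℝ) * x * x := by
            gcongr
            exact (min_le_left _ _).trans h2
        _ = 1 := by
            rw [Real.rpow_neg hx.le, Real.rpow_two]; field_simp
    · have h3 : x ^ (-α) ≤ 1 := Real.rpow_le_one_of_one_le_of_nonpos h1 (by linarith)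
      calc x ^ (-α) * min (x ^ β) 1 * k ≤ 1 * 1 * 1 := by
            gcongr
            exact min_le_right _ _
        _ = 1 := by norm_num
  have hxα : x ^ (-α) ≤ 4 * y ^ (-α) := by
    have h1 : y ^ α ≤ 4 * x ^ α := by
      calc y ^ α ≤ (2 * x) ^ α := by gcongr; linarith
        _ = 2 ^ α * x ^ α := Real.mul_rpow (by norm_num) hx.le
        _ ≤ 2 ^ (2 : ℝ) * x ^ α := by
            gcongr
            norm_num
        _ = 4 * x ^ α := by norm_num
    have hy0 : 0 < y := by linarith
    rw [Real.rpow_neg hx.le, Real.rpow_neg hy0.le, ← div_eq_mul_inv, le_div_iff₀ (by positivity),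
      inv_mul_le_iff₀ (by positivity)]
    linarith
  have hxp : 0 < x ^ (-α) := by positivity
  have hD' : D ≤ (t * k)⁻¹ * (U + V) + t * k * J := by
    have : D = (t * k)⁻¹ * (t * k * D) := by field_simp
    rw [this]
    calc (t * k)⁻¹ * (t * k * D) ≤ (t * k)⁻¹ * (U + V + (t * k) ^ 2 * J) := by gcongr
      _ = _ := by field_simp
  calc x ^ (-α) * min (x ^ β) 1 * D
      ≤ x ^ (-α) * min (x ^ β) 1 * ((t * k)⁻¹ * (U + V) + t * k * J) := by gcongr
    _ = x ^ (-α) * (min (x ^ β) 1 * (t * k)⁻¹) * (U + V)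
        + (x ^ (-α) * min (x ^ β) 1 * k) * (t * J) := by ring
    _ ≤ x ^ (-α) * (2 * k * (t * k)⁻¹) * (U + V) + 1 * (t * J) := by
        refine add_le_add ?_ (mul_le_mul_of_nonneg_right hmk (by positivity))
        gcongr
    _ = 2 * t⁻¹ * (x ^ (-α) * U + x ^ (-α) * V) + t * J := by field_simp
    _ ≤ 2 * t⁻¹ * (4 * y ^ (-α) * U + 4 * (x ^ (-α) * V)) + t * J := by
        have h1 : x ^ (-α) * U ≤ 4 * y ^ (-α) * U := mul_le_mul_of_nonneg_right hxα hU
        have h2 : x ^ (-α) * V ≤ 4 * (x ^ (-α) * V) := by linarith [mul_nonneg hxp.le hV]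
        have h3 := mul_le_mul_of_nonneg_left (add_le_add h1 h2) (by positivity : 0 ≤ 2 * t⁻¹)
        linarith
    _ = 8 * t⁻¹ * (y ^ (-α) * U + x ^ (-α) * V) + t * J := by ring

theorem rpow_le_two_rpow_abs_mul {x y : ℝ} (γ : ℝ) (hx : 0 < x) (hxy : x ≤ y) (hy : y ≤ 2 * x) :
    x ^ γ ≤ 2 ^ |γ| * y ^ γ := by
  have hy0 : 0 < y := by linarith
  rw [← div_le_iff₀ (by positivity), ← Real.div_rpow hx.le hy0.le]
  have h1 : x / y ≤ 1 := (div_le_one hy0).2 hxy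
  have h2 : 2⁻¹ ≤ x / y := by rw [le_div_iff₀ hy0]; linarith
  rcases le_total 0 γ with h | h
  · exact (Real.rpow_le_one (by positivity) h1 h).trans
      (Real.one_le_rpow (by norm_num) (abs_nonneg _))
  · rw [abs_of_nonpos h]
    calc (x / y) ^ γ ≤ 2⁻¹ ^ γ := Real.rpow_le_rpow_of_nonpos (by norm_num) h2 h
      _ = 2 ^ (-γ) := by rw [Real.inv_rpow (by norm_num), Real.rpow_neg (by norm_num)]

theorem le_mul_sqrt_mul_sqrt_add {L A B M : ℝ≥0∞} (hM : M ≠ 0) (hA : A = 0 → L = 0)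
    (h : ∀ t : ℝ, 0 < t → t ≤ 1 → L ≤ M * (ENNReal.ofReal t⁻¹ * A + ENNReal.ofReal t * B)) :
    L ≤ 2 * M * (A ^ ((1 : ℝ) / 2) * B ^ ((1 : ℝ) / 2)) + 2 * M * A := by
  rcases eq_or_ne A 0 with hA0 | hA0
  · simp [hA hA0]
  have hsq : ∀ X : ℝ≥0∞, X ^ ((1 : ℝ) / 2) * X ^ ((1 : ℝ) / 2) = X := fun X => by
    rw [← ENNReal.rpow_add_of_nonneg _ _ (by norm_num) (by norm_num)]; norm_num
  rcases le_total B A with hBA | hAB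
  · refine (h 1 one_pos le_rfl).trans (le_trans ?_ le_add_self)
    calc M * (ENNReal.ofReal 1⁻¹ * A + ENNReal.ofReal 1 * B) ≤ M * (A + A) := by
          gcongr <;> simp [hBA]
      _ = 2 * M * A := by ring
  rcases eq_or_ne B ⊤ with hB | hB
  · have : A ^ ((1 : ℝ) / 2) * B ^ ((1 : ℝ) / 2) = ⊤ := by
      rw [hB, ENNReal.top_rpow_of_pos (by norm_num), ENNReal.mul_top]
      simp [hA0]
    rw [this, ENNReal.mul_top (by simp [hM])]
    simp
  have hAt : A ≠ ⊤ := ne_top_of_le_ne_top hB hAB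
  refine le_trans ?_ le_self_add
  lift A to NNReal using hAt
  lift B to NNReal using hB
  have hA0' : 0 < A := pos_iff_ne_zero.2 (by simpa using hA0)
  have hAB' : A ≤ B := by exact_mod_cast hAB
  have hB0 : 0 < B := hA0'.trans_le hAB'
  set a : NNReal := A ^ ((1 : ℝ) / 2)
  set b : NNReal := B ^ ((1 : ℝ) / 2)
  have ha : 0 < a := NNReal.rpow_pos hA0'
  have hb : 0 < b := NNReal.rpow_pos hB0
  have hab : a ≤ b := NNReal.rpow_le_rpow hAB' (by norm_num)
  have haa : A = a * a := by
    rw [← NNReal.rpow_add hA0'.ne']; norm_num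
  have hbb : B = b * b := by
    rw [← NNReal.rpow_add hB0.ne']; norm_num
  refine (h ((a / b : NNReal) : ℝ) (by positivity) (by
    exact_mod_cast (div_le_one₀ hb).2 hab)).trans_eq ?_
  rw [← NNReal.coe_inv, ENNReal.ofReal_coe_nnreal, ENNReal.ofReal_coe_nnreal,
    ← ENNReal.coe_rpow_of_nonneg _ (by norm_num), ← ENNReal.coe_rpow_of_nonneg _ (by norm_num)]
  change M * (((a / b)⁻¹ : NNReal) * (A : ℝ≥0∞) + ((a / b : NNReal) : ℝ≥0∞) * B) = 2 * M * (a * b)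
  have : (a / b)⁻¹ * A + a / b * B = 2 * (a * b) := by
    rw [haa, hbb]; field_simp; ring
  have h' : (((a / b)⁻¹ : NNReal) * (A : ℝ≥0∞) + ((a / b : NNReal) : ℝ≥0∞) * B)
      = 2 * ((a : ℝ≥0∞) * b) := by exact_mod_cast congrArg ((↑) : NNReal → ℝ≥0∞) this
  rw [h']; ring

theorem add_mul_add_rpow_le {p : ℝ} (hp : 1 ≤ p) (a b X Y Z : ℝ≥0∞) :
    (a * (X + Y) + b * Z) ^ p ≤
      2 ^ (p - 1) * (a ^ p * (2 ^ (p - 1) * (X ^ p + Y ^ p)) + b ^ p * Z ^ p) := by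
  have hp0 : 0 ≤ p := by linarith
  refine (ENNReal.rpow_add_le_mul_rpow_add_rpow _ _ hp).trans ?_
  rw [ENNReal.mul_rpow_of_nonneg _ _ hp0, ENNReal.mul_rpow_of_nonneg _ _ hp0]
  gcongr
  exact ENNReal.rpow_add_le_mul_rpow_add_rpow _ _ hp

/-- Weighted interpolation inequality for one directional derivative, in multiplicative form with
a free parameter `t`. -/
theorem lintegral_weight_mul_deriv_le {E : Type*} [NormedAddCommGroup E] [NormedSpace ℝ E]
    [FiniteDimensional ℝ E] [MeasurableSpace E] [BorelSpace E] (μ : Measure E)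
    [μ.IsAddHaarMeasure] (l : E →L[ℝ] ℝ) {v : E} (hv0 : 0 ≤ l v) (hv1 : l v ≤ 1) {S : Set E}
    (hS : MeasurableSet S) (hpos : ∀ z ∈ S, 0 < l z)
    (hcl : ∀ z ∈ S, ∀ t : ℝ, 0 ≤ t → z + t • v ∈ S)
    {p β α t : ℝ} (γ : ℝ) (hp : 1 < p) (hβ : 1 ≤ β) (hα : α ∈ Ioo (0 : ℝ) 2) (ht : 0 < t)
    (ht1 : t ≤ 1) {u D₁ D₂ G : E → ℝ}
    (hu : ∀ z, ∀ s : ℝ, HasDerivAt (fun r : ℝ => u (z + r • v)) (D₁ (z + s • v)) s)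
    (hD : ∀ z, ∀ s : ℝ, HasDerivAt (fun r : ℝ => D₁ (z + r • v)) (D₂ (z + s • v)) s)
    (hD₂ : Continuous D₂) (hG : Continuous G) (hDG : ∀ z, |D₂ z| ≤ G z) (hum : Continuous u) :
    ∫⁻ z in S, ENNReal.ofReal (l z ^ (-α) * min (l z ^ β) 1 * |D₁ z|) ^ p
        * ENNReal.ofReal (l z ^ γ) ∂μ ≤
      2 ^ (p - 1) * (8 ^ p * 2 ^ (p - 1) * (ENNReal.ofReal (2 ^ |γ|) + 1)
          + ENNReal.ofReal (2 ^ |γ|)) *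
        (ENNReal.ofReal t⁻¹ ^ p * ∫⁻ z in S, ENNReal.ofReal (l z ^ (-α) * |u z|) ^ p
            * ENNReal.ofReal (l z ^ γ) ∂μ
          + ENNReal.ofReal t ^ p * ∫⁻ z in S, ENNReal.ofReal (G z) ^ p
            * ENNReal.ofReal (l z ^ γ) ∂μ) := by
  have hp0 : 0 ≤ p := by linarith
  set k : E → ℝ := fun z => l z / (1 + l z) with hk
  set V : E → ℝ≥0∞ := fun z => ENNReal.ofReal (l z ^ (-α) * |u z|) with hV
  set w : E → ℝ≥0∞ := fun z => ENNReal.ofReal (l z ^ γ) with hw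
  set C : ℝ≥0∞ := ENNReal.ofReal (2 ^ |γ|) with hC
  have hlm : Measurable l := l.continuous.measurable
  have hkm : Measurable k := hlm.div (measurable_const.add hlm)
  have hwm : Measurable w := (hlm.pow_const γ).ennreal_ofReal
  have hVm : Measurable V := ((hlm.pow_const (-α)).mul hum.measurable.abs).ennreal_ofReal
  have hGm : Measurable (fun z => ENNReal.ofReal (G z) ^ p * w z) :=
    (hG.measurable.ennreal_ofReal.pow_const p).mul hwm
  -- the shifted point has comparable height
  have hshift : ∀ z ∈ S, ∀ s : ℝ, 0 ≤ s → s ≤ 1 →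
      l z ≤ l (z + (s * t * k z) • v) ∧ l (z + (s * t * k z) • v) ≤ 2 * l z := by
    intro z hz s hs0 hs1
    have hz0 := hpos z hz
    have hk0 : 0 ≤ k z := by simp only [hk]; positivity
    have hkl : k z ≤ l z := div_le_self hz0.le (by linarith)
    have h1 : 0 ≤ s * t * k z * l v := by positivity
    have h2 : s * t * k z * l v ≤ 1 * 1 * l z * 1 := by gcongr
    simp only [map_add, map_smul, smul_eq_mul]
    constructor <;> linarith
  have hwC : ∀ z ∈ S, ∀ s : ℝ, 0 ≤ s → s ≤ 1 → w z ≤ C * w (z + (s * t * k z) • v) := by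
    intro z hz s hs0 hs1
    obtain ⟨h1, h2⟩ := hshift z hz s hs0 hs1
    rw [hC, hw, ← ENNReal.ofReal_mul (by positivity)]
    exact ENNReal.ofReal_le_ofReal (rpow_le_two_rpow_abs_mul γ (hpos z hz) h1 h2)
  have hpt : ∀ z ∈ S, ENNReal.ofReal (l z ^ (-α) * min (l z ^ β) 1 * |D₁ z|) ≤
      ENNReal.ofReal (8 * t⁻¹) * (V (z + (1 * t * k z) • v) + V z)
        + ENNReal.ofReal t *
          ∫⁻ s in Ioc (0 : ℝ) 1, ENNReal.ofReal (G (z + (s * t * k z) • v)) := by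
    intro z hz
    have hz0 := hpos z hz
    have hk0 : 0 ≤ k z := by simp only [hk]; positivity
    set h := t * k z with hh
    have hh0 : 0 ≤ h := by positivity
    have hsc : ∀ s : ℝ, HasDerivAt (fun r : ℝ => r * h) h s := fun s => by
      simpa using (hasDerivAt_id s).mul_const h
    have hf : ∀ s : ℝ, HasDerivAt (fun r : ℝ => u (z + (r * h) • v))
        (D₁ (z + (s * h) • v) * h) s := fun s =>
      (hu z (s * h)).comp (h := fun r : ℝ => r * h) s (hsc s)
    have hf' : ∀ s : ℝ, HasDerivAt (fun r : ℝ => D₁ (z + (r * h) • v) * h)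
        (D₂ (z + (s * h) • v) * h * h) s := fun s =>
      ((hD z (s * h)).comp (h := fun r : ℝ => r * h) s (hsc s)).mul_const h
    have hcG : Continuous (fun s : ℝ => G (z + (s * h) • v)) := by fun_prop
    have hcD : Continuous (fun s : ℝ => D₂ (z + (s * h) • v) * h * h) := by fun_prop
    have hT := abs_deriv_zero_le hf hf' hcD
    have hG0 : ∀ z, 0 ≤ G z := fun z => (abs_nonneg _).trans (hDG z)
    have hJ : ∫ s in (0 : ℝ)..1, |D₂ (z + (s * h) • v) * h * h|
        ≤ h ^ 2 * ∫ s in (0 : ℝ)..1, G (z + (s * h) • v) := by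
      rw [← intervalIntegral.integral_const_mul]
      refine intervalIntegral.integral_mono_on zero_le_one (hcD.abs.intervalIntegrable _ _)
        ((hcG.const_mul _).intervalIntegrable _ _) fun s _ => ?_
      rw [abs_mul, abs_mul, abs_of_nonneg hh0]
      nlinarith [mul_le_mul_of_nonneg_left (hDG (z + (s * h) • v)) (mul_nonneg hh0 hh0)]
    have hJ0 : 0 ≤ ∫ s in (0 : ℝ)..1, G (z + (s * h) • v) :=
      intervalIntegral.integral_nonneg zero_le_one fun s _ => hG0 _
    obtain ⟨hs1, hs2⟩ := hshift z hz 1 zero_le_one le_rfl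
    have hT' : h * |D₁ z| ≤ |u (z + (1 * t * k z) • v)| + |u z|
        + h ^ 2 * ∫ s in (0 : ℝ)..1, G (z + (s * h) • v) := by
      have e : |D₁ (z + ((0 : ℝ) * h) • v) * h| = h * |D₁ z| := by
        rw [abs_mul, abs_of_nonneg hh0, mul_comm]; simp
      rw [e] at hT
      rw [zero_mul, zero_smul, add_zero] at hT
      rw [mul_assoc 1, ← hh]
      linarith
    have hreal := weight_mul_le hz0 hβ hα ht hs1 hs2 (abs_nonneg _) (abs_nonneg _)
      hJ0 hT'
    have hJe : ENNReal.ofReal (∫ s in (0 : ℝ)..1, G (z + (s * h) • v))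
        = ∫⁻ s in Ioc (0 : ℝ) 1, ENNReal.ofReal (G (z + (s * t * k z) • v)) := by
      rw [intervalIntegral.integral_of_le zero_le_one,
        ofReal_integral_eq_lintegral_ofReal
          ((hcG.intervalIntegrable 0 1).1) (ae_of_all _ fun s => hG0 _)]
      simp only [hh, mul_assoc]
    rw [← hJe]
    refine (ENNReal.ofReal_le_ofReal hreal).trans_eq ?_
    have hy0 := hz0.trans_le hs1
    rw [ENNReal.ofReal_add (by positivity) (by positivity), ENNReal.ofReal_mul (by positivity),
      ENNReal.ofReal_add (by positivity) (by positivity), ENNReal.ofReal_mul ht.le]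
  have hpt' : ∀ z ∈ S, ENNReal.ofReal (l z ^ (-α) * min (l z ^ β) 1 * |D₁ z|) ^ p * w z ≤
      2 ^ (p - 1) * (ENNReal.ofReal (8 * t⁻¹) ^ p * (2 ^ (p - 1) *
        (C * (V (z + (1 * t * k z) • v) ^ p * w (z + (1 * t * k z) • v)) + V z ^ p * w z))
        + ENNReal.ofReal t ^ p * (C * ∫⁻ s in Ioc (0 : ℝ) 1,
          ENNReal.ofReal (G (z + (s * t * k z) • v)) ^ p * w (z + (s * t * k z) • v))) := by
    intro z hz
    have hmeas : Measurable fun s : ℝ => ENNReal.ofReal (G (z + (s * t * k z) • v)) := by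
      have : Continuous fun s : ℝ => G (z + (s * t * k z) • v) := by fun_prop
      exact this.measurable.ennreal_ofReal
    have hprob : IsProbabilityMeasure (volume.restrict (Ioc (0 : ℝ) 1)) := ⟨by simp⟩
    have hJen := lintegral_rpow_le_lintegral_rpow (volume.restrict (Ioc (0 : ℝ) 1)) hp
      hmeas.aemeasurable
    have h1 : V (z + (1 * t * k z) • v) ^ p * w z ≤
        C * (V (z + (1 * t * k z) • v) ^ p * w (z + (1 * t * k z) • v)) := by
      rw [mul_left_comm]
      gcongr
      exact hwC z hz 1 zero_le_one le_rfl
    have h2 : (∫⁻ s in Ioc (0 : ℝ) 1, ENNReal.ofReal (G (z + (s * t * k z) • v))) ^ p * w z ≤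
        C * ∫⁻ s in Ioc (0 : ℝ) 1,
          ENNReal.ofReal (G (z + (s * t * k z) • v)) ^ p * w (z + (s * t * k z) • v) := by
      refine (mul_le_mul_left hJen (w z)).trans ?_
      rw [← lintegral_mul_const _ (hmeas.pow_const p), ← lintegral_const_mul' _ _ (by simp [hC])]
      refine setLIntegral_mono' measurableSet_Ioc fun s hs => ?_
      rw [mul_left_comm]
      gcongr
      exact hwC z hz s hs.1.le hs.2
    calc _ ≤ (ENNReal.ofReal (8 * t⁻¹) * (V (z + (1 * t * k z) • v) + V z)
            + ENNReal.ofReal t *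
            ∫⁻ s in Ioc (0 : ℝ) 1, ENNReal.ofReal (G (z + (s * t * k z) • v))) ^ p * w z := by
          gcongr
          exact hpt z hz
      _ ≤ _ := mul_le_mul_left (add_mul_add_rpow_le hp.le _ _ _ _ _) (w z)
      _ = 2 ^ (p - 1) * (ENNReal.ofReal (8 * t⁻¹) ^ p * (2 ^ (p - 1) *
            (V (z + (1 * t * k z) • v) ^ p * w z + V z ^ p * w z))
            + ENNReal.ofReal t ^ p *
            ((∫⁻ s in Ioc (0 : ℝ) 1, ENNReal.ofReal (G (z + (s * t * k z) • v))) ^ p * w z)) := by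
          ring
      _ ≤ _ := by gcongr
  have hVwm : Measurable fun z => V z ^ p * w z := (hVm.pow_const p).mul hwm
  have hφm : Measurable fun q : E × ℝ => q.1 + (q.2 * t * k q.1) • v := by fun_prop
  have hφ1 : Measurable fun z : E => z + (1 * t * k z) • v := by fun_prop
  set A := ∫⁻ z in S, V z ^ p * w z ∂μ with hA
  set B := ∫⁻ z in S, ENNReal.ofReal (G z) ^ p * w z ∂μ with hB
  have hA1 : ∫⁻ z in S, V (z + (1 * t * k z) • v) ^ p * w (z + (1 * t * k z) • v) ∂μ ≤ A :=
    lintegral_comp_add_smul_le μ l hv0 hS hpos hcl (by positivity) fun z => V z ^ p * w z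
  have hB1 : ∫⁻ z in S, (∫⁻ s in Ioc (0 : ℝ) 1, ENNReal.ofReal (G (z + (s * t * k z) • v)) ^ p
      * w (z + (s * t * k z) • v)) ∂μ ≤ B := by
    have hm : AEMeasurable (Function.uncurry fun (z : E) (s : ℝ) =>
        ENNReal.ofReal (G (z + (s * t * k z) • v)) ^ p * w (z + (s * t * k z) • v))
        ((μ.restrict S).prod (volume.restrict (Ioc (0 : ℝ) 1))) := (hGm.comp hφm).aemeasurable
    rw [lintegral_lintegral_swap hm]
    calc _ ≤ ∫⁻ s in Ioc (0 : ℝ) 1, B := by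
          refine setLIntegral_mono' measurableSet_Ioc fun s hs => ?_
          exact lintegral_comp_add_smul_le μ l hv0 hS hpos hcl (mul_nonneg hs.1.le ht.le)
            fun z => ENNReal.ofReal (G z) ^ p * w z
      _ = B := by simp
  have h2p : (2 : ℝ≥0∞) ^ (p - 1) ≠ ⊤ := by simp
  have hrp : ∀ r : ℝ, ENNReal.ofReal r ^ p ≠ ⊤ := fun r =>
    ENNReal.rpow_ne_top_of_nonneg hp0 ENNReal.ofReal_ne_top
  refine (setLIntegral_mono' hS hpt').trans ?_
  rw [lintegral_const_mul' _ _ h2p, lintegral_add_left (by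
      exact ((((hVwm.comp hφ1).const_mul C).add hVwm).const_mul _).const_mul _),
    lintegral_const_mul' _ _ (hrp _), lintegral_const_mul' _ _ h2p,
    lintegral_add_left (by exact (hVwm.comp hφ1).const_mul C),
    lintegral_const_mul' _ _ (by simp [hC]), lintegral_const_mul' _ _ (hrp _),
    lintegral_const_mul' _ _ (by simp [hC])]
  rw [ENNReal.ofReal_mul (by norm_num), ENNReal.mul_rpow_of_nonneg _ _ hp0]
  calc _ ≤ 2 ^ (p - 1) * (ENNReal.ofReal 8 ^ p * ENNReal.ofReal t⁻¹ ^ p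
          * (2 ^ (p - 1) * (C * A + A)) + ENNReal.ofReal t ^ p * (C * B)) := by gcongr
    _ = 2 ^ (p - 1) * ((8 ^ p * 2 ^ (p - 1) * (C + 1)) * (ENNReal.ofReal t⁻¹ ^ p * A)
          + C * (ENNReal.ofReal t ^ p * B)) := by
        rw [show ENNReal.ofReal 8 = 8 by simp]
        ring
    _ ≤ 2 ^ (p - 1) * ((8 ^ p * 2 ^ (p - 1) * (C + 1) + C) * (ENNReal.ofReal t⁻¹ ^ p * A)
          + (8 ^ p * 2 ^ (p - 1) * (C + 1) + C) * (ENNReal.ofReal t ^ p * B)) := by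
        gcongr
        · exact le_self_add
        · exact le_add_self
    _ = _ := by ring

theorem fderiv_section_eq {d : ℕ} {F : Type*} [NormedAddCommGroup F] [NormedSpace ℝ F]
    {f : ℝ × Ed d → F} {z : ℝ × Ed d} (hf : DifferentiableAt ℝ f z) :
    fderiv ℝ (fun y => f (z.1, y)) z.2
      = (fderiv ℝ f z).comp (ContinuousLinearMap.inr ℝ ℝ (Ed d)) :=
  (HasFDerivAt.comp (f := fun y => (z.1, y)) z.2 hf.hasFDerivAt
    (hasFDerivAt_prodMk_right z.1 z.2)).fderiv

theorem contDiff_fderiv_section {d : ℕ} {F : Type*} [NormedAddCommGroup F] [NormedSpace ℝ F]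
    {f : ℝ × Ed d → F} (hf : ContDiff ℝ (⊤ : ℕ∞) f) :
    ContDiff ℝ (⊤ : ℕ∞) (fun z : ℝ × Ed d => fderiv ℝ (fun y => f (z.1, y)) z.2) := by
  have h : (fun z : ℝ × Ed d => fderiv ℝ (fun y => f (z.1, y)) z.2)
      = fun z => (fderiv ℝ f z).comp (ContinuousLinearMap.inr ℝ ℝ (Ed d)) :=
    funext fun z => fderiv_section_eq (hf.differentiable (by simp) z)
  rw [h]
  exact (hf.fderiv_right (m := (⊤ : ℕ∞)) le_rfl).clm_comp contDiff_const

theorem hasDerivAt_section_line {d : ℕ} {F : Type*} [NormedAddCommGroup F] [NormedSpace ℝ F]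
    {f : ℝ × Ed d → F} (hf : ContDiff ℝ (⊤ : ℕ∞) f) (e : Ed d) (z : ℝ × Ed d) (s : ℝ) :
    HasDerivAt (fun r : ℝ => f (z + r • ((0 : ℝ), e)))
      (fderiv ℝ (fun y => f ((z + s • ((0 : ℝ), e)).1, y)) (z + s • ((0 : ℝ), e)).2 e) s := by
  rw [fderiv_section_eq (hf.differentiable (by simp) _)]
  have h : HasDerivAt (fun r : ℝ => z + r • ((0 : ℝ), e)) ((0 : ℝ), e) s := by
    simpa using ((hasDerivAt_id s).smul_const ((0 : ℝ), e)).const_add z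
  exact (hf.differentiable (by simp) _).hasFDerivAt.comp_hasDerivAt s h

theorem opNorm_le_sum_abs_single {d : ℕ} (L : Ed d →L[ℝ] ℝ) :
    ‖L‖ ≤ ∑ i, |L (EuclideanSpace.single i 1)| := by
  refine L.opNorm_le_bound (by positivity) fun x => ?_
  have hx : L x = ∑ i, x i * L (EuclideanSpace.single i 1) := by
    conv_lhs => rw [← (EuclideanSpace.basisFun (Fin d) ℝ).sum_repr x]
    simp
  rw [hx, Finset.sum_mul]
  refine (norm_sum_le _ _).trans (Finset.sum_le_sum fun i _ => ?_)
  rw [norm_mul, mul_comm, Real.norm_eq_abs]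
  gcongr
  exact PiLp.norm_apply_le x i

theorem wLp_eq (d : ℕ) (T : EReal) {p : ℝ} (hp : 0 ≤ p) (γ : ℝ) (g : ℝ × Ed d → ℝ) :
    wLp d T p γ g = (∫⁻ z in OmegaT d T,
      ENNReal.ofReal |g z| ^ p * ENNReal.ofReal (xd z.2 ^ γ)) ^ (1 / p) := by
  simp only [wLp]
  congr 2
  ext z
  rw [ENNReal.ofReal_mul (by positivity), ENNReal.ofReal_rpow_of_nonneg (abs_nonneg _) hp]

/-- The last coordinate as a continuous linear functional on space-time. -/
def xdCLM {d : ℕ} (hd : 0 < d) : ℝ × Ed d →L[ℝ] ℝ :=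
  (EuclideanSpace.proj (𝕜 := ℝ) (⟨d - 1, Nat.sub_lt hd one_pos⟩ : Fin d)).comp
    (ContinuousLinearMap.snd ℝ ℝ (Ed d))

theorem xdCLM_apply {d : ℕ} (hd : 0 < d) (z : ℝ × Ed d) : xdCLM hd z = xd z.2 := by
  simp [xdCLM, xd, hd]

theorem continuous_xd_snd {d : ℕ} (hd : 0 < d) : Continuous fun z : ℝ × Ed d => xd z.2 :=
  (xdCLM hd).continuous.congr (xdCLM_apply hd)

theorem isOpen_OmegaT {d : ℕ} (hd : 0 < d) (T : EReal) : IsOpen (OmegaT d T) :=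
  (isOpen_Iio.preimage (continuous_coe_real_ereal.comp continuous_fst)).inter
    (isOpen_Ioi.preimage (continuous_xd_snd hd))

theorem eq_zero_of_wLp_eq_zero {d : ℕ} (hd : 0 < d) {T : EReal} {p γ α : ℝ} (hp : 0 < p)
    {u : ℝ × Ed d → ℝ} (hu : Continuous u) (hsupp : tsupport u ⊆ OmegaT d T)
    (h : wLp d T p γ (fun z => xd z.2 ^ (-α) * u z) = 0) : u = 0 := by
  have hxm : Measurable fun z : ℝ × Ed d => xd z.2 :=
    (continuous_xd_snd hd).measurable
  have hΩ := isOpen_OmegaT hd T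
  rw [wLp, ENNReal.rpow_eq_zero_iff_of_pos (by positivity), lintegral_eq_zero_iff (by
    exact ((((hxm.pow_const _).mul hu.measurable).abs.pow_const p).mul
      (hxm.pow_const γ)).ennreal_ofReal)] at h
  have hae : u =ᵐ[volume.restrict (OmegaT d T)] 0 := by
    filter_upwards [h, ae_restrict_mem hΩ.measurableSet] with z hz hzΩ
    have hx : 0 < xd z.2 := hzΩ.2
    by_contra hne
    have hne' : 0 < |u z| := abs_pos.2 hne
    have : 0 < |xd z.2 ^ (-α) * u z| ^ p * xd z.2 ^ γ := by
      rw [abs_mul, abs_of_pos (by positivity)]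
      positivity
    exact absurd hz (ENNReal.ofReal_pos.2 this).ne'
  have hEq := Measure.eqOn_open_of_ae_eq hae hΩ hu.continuousOn continuousOn_const
  ext z
  by_cases hz : z ∈ OmegaT d T
  · exact hEq hz
  · exact image_eq_zero_of_notMem_tsupport fun h' => hz (hsupp h')

/-- Lemma 5.3 (i): interpolation inequality with `ℓ = 1`, `β ≥ 1`:
`‖x_d^{-α} min{x_d^β,1} |Du|‖_{L_p} ≤ N ‖χ^{-α}u‖^{1/2} ‖D²u‖^{1/2} + N ‖χ^{-α}u‖`. -/
theorem stmt16 (d : ℕ) (hd : 1 ≤ d) (p β γ : ℝ)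
    (hp : 1 < p) (hβ : 1 ≤ β) (hγ : -1 < γ) :
    ∃ N : ℝ, 0 < N ∧
      ∀ (T : EReal) (α : ℝ), α ∈ Set.Ioo (0 : ℝ) 2 →
        ∀ u : ℝ × Ed d → ℝ, ContDiff ℝ (⊤ : ℕ∞) u → HasCompactSupport u →
          tsupport u ⊆ OmegaT d T →
          wLp d T p γ (fun z => xd z.2 ^ (-α) * min (xd z.2 ^ β) 1 * ‖Du u z‖)
            ≤ ENNReal.ofReal N *
                ((wLp d T p γ (fun z => xd z.2 ^ (-α) * u z)) ^ ((1 : ℝ) / 2) *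
                  (wLp d T p γ (fun z => ‖D2u u z‖)) ^ ((1 : ℝ) / 2))
              + ENNReal.ofReal N * wLp d T p γ (fun z => xd z.2 ^ (-α) * u z) := by
  have hd0 : 0 < d := hd
  have hp0 : 0 < p := by linarith
  set K : ℝ≥0∞ := 2 ^ (p - 1) * (8 ^ p * 2 ^ (p - 1) * (ENNReal.ofReal (2 ^ |γ|) + 1)
    + ENNReal.ofReal (2 ^ |γ|))
  have hKt : K ≠ ⊤ := by
    have h8 : (8 : ℝ≥0∞) ^ p ≠ ⊤ := by simp
    have h2 : (2 : ℝ≥0∞) ^ (p - 1) ≠ ⊤ := by simp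
    finiteness
  set M : ℝ≥0∞ := ((d : ℝ≥0∞) ^ (p - 1) * (d * K)) ^ (1 / p) + 1 with hM
  have hMt : M ≠ ⊤ := by
    have h1 : (d : ℝ≥0∞) ^ (p - 1) ≠ ⊤ :=
      ENNReal.rpow_ne_top_of_nonneg (by linarith) (by simp)
    have h2 : ((d : ℝ≥0∞) ^ (p - 1) * (d * K)) ^ (1 / p) ≠ ⊤ :=
      ENNReal.rpow_ne_top_of_nonneg (by positivity) (by finiteness)
    finiteness
  have hM0 : M ≠ 0 := by simp [hM]
  have h2M : 2 * M ≠ ⊤ := by finiteness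
  refine ⟨(2 * M).toReal, ENNReal.toReal_pos (by simp [hM0]) h2M, ?_⟩
  intro T α hα u hu _ hsupp
  rw [ENNReal.ofReal_toReal h2M]
  have hDu : ContDiff ℝ (⊤ : ℕ∞) (Du u) := contDiff_fderiv_section hu
  have hD2u : ContDiff ℝ (⊤ : ℕ∞) (D2u u) := contDiff_fderiv_section hDu
  have hΩ := (isOpen_OmegaT hd0 T).measurableSet
  refine le_mul_sqrt_mul_sqrt_add hM0 (fun hA => ?_) fun t ht ht1 => ?_
  · obtain rfl := eq_zero_of_wLp_eq_zero hd0 hp0 hu.continuous hsupp hA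
    simp [wLp, Du, hp0, hp0.ne']
  have hdir : ∀ i : Fin d, ∫⁻ z in OmegaT d T, ENNReal.ofReal (xd z.2 ^ (-α) * min (xd z.2 ^ β) 1
      * |Du u z (EuclideanSpace.single i 1)|) ^ p * ENNReal.ofReal (xd z.2 ^ γ) ≤
      K * (ENNReal.ofReal t⁻¹ ^ p * (∫⁻ z in OmegaT d T, ENNReal.ofReal (xd z.2 ^ (-α) * |u z|) ^ p
          * ENNReal.ofReal (xd z.2 ^ γ))
        + ENNReal.ofReal t ^ p * ∫⁻ z in OmegaT d T, ENNReal.ofReal ‖D2u u z‖ ^ p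
          * ENNReal.ofReal (xd z.2 ^ γ)) := by
    intro i
    set e : Ed d := EuclideanSpace.single i 1 with he
    have hxe : xd e = 0 ∨ xd e = 1 := by
      simp only [xd, hd0, he, dite_true, PiLp.single_apply]
      split_ifs <;> simp
    have hle : xdCLM hd0 ((0 : ℝ), e) = xd e := xdCLM_apply _ _
    have hle0 : 0 ≤ xdCLM hd0 ((0 : ℝ), e) := by rw [hle]; rcases hxe with h | h <;> simp [h]
    have hle1 : xdCLM hd0 ((0 : ℝ), e) ≤ 1 := by rw [hle]; rcases hxe with h | h <;> simp [h]
    have hne : ‖e‖ = 1 := by simp [he]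
    have hHaar : (volume : Measure (ℝ × Ed d)).IsAddHaarMeasure :=
      Measure.prod.instIsAddHaarMeasure volume volume
    have h := lintegral_weight_mul_deriv_le (volume : Measure (ℝ × Ed d)) (xdCLM hd0) hle0 hle1 hΩ
      (fun z hz => by rw [xdCLM_apply]; exact hz.2)
      (fun z hz r hr => by
        refine ⟨by simpa using hz.1, ?_⟩
        rw [← xdCLM_apply hd0, map_add, map_smul, smul_eq_mul, xdCLM_apply]
        exact add_pos_of_pos_of_nonneg hz.2 (mul_nonneg hr hle0))
      γ hp hβ hα ht ht1 (u := u) (D₁ := fun z => Du u z e) (D₂ := fun z => D2u u z e e)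
      (G := fun z => ‖D2u u z‖) (fun z s => hasDerivAt_section_line hu e z s)
      (fun z s => (hasDerivAt_section_line hDu e z s).clm_apply (hasDerivAt_const s e) |>.congr_deriv
        (by simp [D2u]))
      (by have := hD2u.continuous; fun_prop) (hD2u.continuous.norm (E := Ed d →L[ℝ] Ed d →L[ℝ] ℝ))
      (fun z => by simpa [hne] using (D2u u z).le_opNorm₂ e e) hu.continuous
    simpa only [xdCLM_apply] using h
  have hwpos : ∀ z ∈ OmegaT d T, 0 ≤ xd z.2 ^ (-α) * min (xd z.2 ^ β) 1 := fun z hz => by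
    have : 0 < xd z.2 := hz.2
    positivity
  rw [wLp_eq d T hp0.le, wLp_eq d T hp0.le, wLp_eq d T hp0.le]
  set A := ∫⁻ z in OmegaT d T, ENNReal.ofReal |xd z.2 ^ (-α) * u z| ^ p
    * ENNReal.ofReal (xd z.2 ^ γ) with hA
  set B := ∫⁻ z in OmegaT d T, ENNReal.ofReal |‖D2u u z‖| ^ p
    * ENNReal.ofReal (xd z.2 ^ γ) with hB
  have hA' : ∫⁻ z in OmegaT d T, ENNReal.ofReal (xd z.2 ^ (-α) * |u z|) ^ p
      * ENNReal.ofReal (xd z.2 ^ γ) = A := by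
    refine setLIntegral_congr_fun hΩ fun z hz => ?_
    have : 0 < xd z.2 := hz.2
    simp only [abs_mul, abs_of_pos (Real.rpow_pos_of_pos this (-α))]
  have hB' : ∫⁻ z in OmegaT d T, ENNReal.ofReal ‖D2u u z‖ ^ p
      * ENNReal.ofReal (xd z.2 ^ γ) = B := by
    simp only [hB, fun z => abs_of_nonneg (norm_nonneg (D2u u z))]
  rw [hA', hB'] at hdir
  have hsum : ∫⁻ z in OmegaT d T, ENNReal.ofReal |xd z.2 ^ (-α) * min (xd z.2 ^ β) 1 * ‖Du u z‖| ^ p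
      * ENNReal.ofReal (xd z.2 ^ γ) ≤
      (d : ℝ≥0∞) ^ (p - 1) * (d * K) * (ENNReal.ofReal t⁻¹ ^ p * A + ENNReal.ofReal t ^ p * B) := by
    calc _ ≤ ∫⁻ z in OmegaT d T, (d : ℝ≥0∞) ^ (p - 1) * ∑ i : Fin d,
            ENNReal.ofReal (xd z.2 ^ (-α) * min (xd z.2 ^ β) 1
              * |Du u z (EuclideanSpace.single i 1)|) ^ p * ENNReal.ofReal (xd z.2 ^ γ) := by
          refine setLIntegral_mono' hΩ fun z hz => ?_
          have hw := hwpos z hz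
          have h1 : ENNReal.ofReal |xd z.2 ^ (-α) * min (xd z.2 ^ β) 1 * ‖Du u z‖| ≤
              ∑ i : Fin d, ENNReal.ofReal (xd z.2 ^ (-α) * min (xd z.2 ^ β) 1
                * |Du u z (EuclideanSpace.single i 1)|) := by
            rw [← ENNReal.ofReal_sum_of_nonneg (fun i _ => by positivity), ← Finset.mul_sum,
              abs_of_nonneg (by positivity)]
            exact ENNReal.ofReal_le_ofReal
              (mul_le_mul_of_nonneg_left (opNorm_le_sum_abs_single _) hw)
          rw [← Finset.sum_mul, ← mul_assoc]
          gcongr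
          refine (ENNReal.rpow_le_rpow h1 hp0.le).trans ?_
          simpa using ENNReal.rpow_sum_le_const_mul_sum_rpow Finset.univ
            (fun i : Fin d => ENNReal.ofReal (xd z.2 ^ (-α) * min (xd z.2 ^ β) 1
                * |Du u z (EuclideanSpace.single i 1)|)) hp.le
      _ = (d : ℝ≥0∞) ^ (p - 1) * ∑ i : Fin d, ∫⁻ z in OmegaT d T,
            ENNReal.ofReal (xd z.2 ^ (-α) * min (xd z.2 ^ β) 1
              * |Du u z (EuclideanSpace.single i 1)|) ^ p * ENNReal.ofReal (xd z.2 ^ γ) := by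
          rw [lintegral_const_mul' _ _
            (ENNReal.rpow_ne_top_of_nonneg (by linarith) (by simp)), lintegral_finsetSum]
          intro i _
          have hxm := (continuous_xd_snd hd0).measurable
          have hDm : Measurable fun z => Du u z (EuclideanSpace.single i 1) :=
            (hDu.continuous.clm_apply continuous_const).measurable
          exact ((((hxm.pow_const _).mul ((hxm.pow_const _).min measurable_const)).mul
            hDm.abs).ennreal_ofReal.pow_const p).mul (hxm.pow_const γ).ennreal_ofReal
      _ ≤ (d : ℝ≥0∞) ^ (p - 1) * ∑ i : Fin d, K *
            (ENNReal.ofReal t⁻¹ ^ p * A + ENNReal.ofReal t ^ p * B) := by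
          gcongr with i
          exact hdir i
      _ = _ := by
          simp only [Finset.sum_const, Finset.card_univ, Fintype.card_fin, nsmul_eq_mul]
          ring
  have hp1 : 0 ≤ 1 / p := by positivity
  have hroot : ∀ a X : ℝ≥0∞, (a ^ p * X) ^ (1 / p) = a * X ^ (1 / p) := fun a X => by
    rw [ENNReal.mul_rpow_of_nonneg _ _ hp1, ← ENNReal.rpow_mul, mul_one_div_cancel hp0.ne',
      ENNReal.rpow_one]
  refine (ENNReal.rpow_le_rpow hsum hp1).trans ?_
  rw [ENNReal.mul_rpow_of_nonneg _ _ hp1]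
  refine mul_le_mul' le_self_add ?_
  refine (ENNReal.rpow_add_le_add_rpow _ _ hp1 ((div_le_one hp0).2 hp.le)).trans_eq ?_
  rw [hroot, hroot]
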